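/- Let (R_n(x))_{n≥1} be the sequence of real polynomials defined by R_{n+1}(x) = (nx^2+1)·R_n(x) + x(1−x^2)·R_n′(x) with R_1(x) = 1+x, and let T_n(x) = Σ_{π∈S_n} x^{udrun(π)} be the up-down run polynomial. Then for every n ≥ 1, x·R_n(x) = (1+x)·T_n(x). -/

import Mathlib

open Polynomial Finset

/-- The value `π(i)` of a permutation of `[n]` at position `i ∈ [n]`
(1-indexed), with the convention `π(0) = 0`. -/
def pval (n : ℕ) (π : Equiv.Perm (Fin n)) (i : ℕ) : ℤ :=
  if h : 1 ≤ i ∧ i ≤ n then ((π ⟨i - 1, by omega⟩ : Fin n).val + 1 : ℤ) else 0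

/-- The interior peak number
`ipk(π) = #{i ∈ [2, n-1] : π(i-1) < π(i) > π(i+1)}`. -/
def ipk (n : ℕ) (π : Equiv.Perm (Fin n)) : ℕ :=
  ((Finset.Icc 2 (n - 1)).filter
    (fun i => pval n π (i - 1) < pval n π i ∧ pval n π (i + 1) < pval n π i)).card

/-- The left peak number
`lpk(π) = #{i ∈ [n-1] : π(i-1) < π(i) > π(i+1)}` with `π(0) = 0`. -/
def lpk (n : ℕ) (π : Equiv.Perm (Fin n)) : ℕ :=
  ((Finset.Icc 1 (n - 1)).filter
    (fun i => pval n π (i - 1) < pval n π i ∧ pval n π (i + 1) < pval n π i)).card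

/-- The interior peak polynomial `W_n(x) = Σ_{π ∈ S_n} x^{ipk(π)}`. -/
noncomputable def Wpoly (n : ℕ) : Polynomial ℝ :=
  ∑ π : Equiv.Perm (Fin n), X ^ ipk n π

/-- The left peak polynomial `W̄_n(x) = Σ_{π ∈ S_n} x^{lpk(π)}`. -/
noncomputable def Wbarpoly (n : ℕ) : Polynomial ℝ :=
  ∑ π : Equiv.Perm (Fin n), X ^ lpk n π

/-- The number of up-down runs of `π`, i.e. the number of maximal monotone
consecutive blocks of the sequence `0, π(1), …, π(n)`.  Since consecutive
entries of this sequence are distinct, for `n ≥ 1` this number equals one plus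
the number of interior direction changes (peaks or valleys) of the sequence. -/
def udrun (n : ℕ) (π : Equiv.Perm (Fin n)) : ℕ :=
  if n = 0 then 0
  else
    1 + ((Finset.Icc 1 (n - 1)).filter
      (fun i =>
        (pval n π (i - 1) < pval n π i ∧ pval n π (i + 1) < pval n π i) ∨
        (pval n π i < pval n π (i - 1) ∧ pval n π i < pval n π (i + 1)))).card

/-- The up-down run polynomial `T_n(x) = Σ_{π ∈ S_n} x^{udrun(π)}`. -/
noncomputable def Tpoly (n : ℕ) : Polynomial ℝ :=
  ∑ π : Equiv.Perm (Fin n), X ^ udrun n π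

/-- `T_n^E(x) = Σ_{π ∈ S_n, π(n-1) > π(n)} x^{lpk(π)}` (with `π(0) = 0`). -/
noncomputable def TEpoly (n : ℕ) : Polynomial ℝ :=
  ∑ π ∈ Finset.univ.filter
      (fun π : Equiv.Perm (Fin n) => pval n π n < pval n π (n - 1)),
    X ^ lpk n π

/-- `T_n^O(x) = Σ_{π ∈ S_n, π(n-1) < π(n)} x^{lpk(π)}` (with `π(0) = 0`). -/
noncomputable def TOpoly (n : ℕ) : Polynomial ℝ :=
  ∑ π ∈ Finset.univ.filter
      (fun π : Equiv.Perm (Fin n) => pval n π (n - 1) < pval n π n),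
    X ^ lpk n π

/-- The number of `i < m` with `v i ≠ v (i + 1)`. -/
def numChanges (v : ℕ → Bool) (m : ℕ) : ℕ :=
  ∑ i ∈ range m, if v i = v (i + 1) then 0 else 1

/-- The word of ascents (`true`) and descents (`false`) obtained from `v` when a new maximum is
inserted right after the entry with index `p` of the underlying sequence. -/
def insertPeak (p : ℕ) (v : ℕ → Bool) (i : ℕ) : Bool :=
  if i < p then v i else if i = p then true else if i = p + 1 then false else v (i - 1)

lemma numChanges_succ (v : ℕ → Bool) (m : ℕ) :
    numChanges v (m + 1) =
      numChanges (fun i => v (i + 1)) m + if v 0 = v 1 then 0 else 1 := by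
  simp [numChanges, sum_range_succ']

lemma insertPeak_succ_comp_succ (p : ℕ) (v : ℕ → Bool) :
    (fun i => insertPeak (p + 1) v (i + 1)) = insertPeak p (fun i => v (i + 1)) := by
  funext i
  rcases i with _ | i
  · rcases p with _ | p <;> simp [insertPeak]
  · simp [insertPeak]

lemma insertPeak_succ_zero (p : ℕ) (v : ℕ → Bool) : insertPeak (p + 1) v 0 = v 0 := by
  simp [insertPeak]

lemma numChanges_insertPeak_succ (p m : ℕ) (v : ℕ → Bool) :
    numChanges (insertPeak (p + 1) v) (m + 1) =
      numChanges (insertPeak p (fun i => v (i + 1))) m +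
        if v 0 = insertPeak p (fun i => v (i + 1)) 0 then 0 else 1 := by
  rw [numChanges_succ, insertPeak_succ_comp_succ, insertPeak_succ_zero,
    ← insertPeak_succ_comp_succ]

lemma numChanges_insertPeak_zero (m : ℕ) (v : ℕ → Bool) :
    numChanges (insertPeak 0 v) (m + 2) =
      numChanges (fun i => v (i + 1)) m + (if v 1 = false then 0 else 1) + 1 := by
  rw [numChanges_succ, numChanges_succ]
  have h : (fun i => insertPeak 0 v (i + 1 + 1)) = fun i => v (i + 1) := by
    funext i
    simp [insertPeak]
  rw [h]
  cases h1 : v 1 <;> simp [insertPeak, h1]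

theorem sum_pow_numChanges_insertPeak (m : ℕ) (v : ℕ → Bool) :
    ∑ p ∈ range (m + 2), (X : ℝ[X]) ^ numChanges (insertPeak p v) (m + 1) =
      (numChanges v m : ℝ[X]) * X ^ numChanges v m + X ^ (numChanges v m + 1) +
        ((m : ℝ[X]) - (numChanges v m : ℝ[X])) * X ^ (numChanges v m + 2) +
        (if v 0 = true then (X : ℝ[X]) ^ numChanges v m else X ^ (numChanges v m + 1)) := by
  induction m generalizing v with
  | zero =>
    cases h : v 0 <;> simp [sum_range_succ, numChanges, insertPeak, h]
  | succ m ih =>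
    have ih' := ih (fun i => v (i + 1))
    rw [sum_range_succ'] at ih' ⊢
    rw [sum_range_succ']
    have h (p : ℕ) : insertPeak (p + 1) (fun i => v (i + 1)) 0 = v 1 := by
      simp [insertPeak]
    have h' : insertPeak 0 (fun i => v (i + 1)) 0 = true := by
      simp [insertPeak]
    simp only [numChanges_insertPeak_succ _ (m + 1), numChanges_insertPeak_zero m v,
      numChanges_succ v m, h, h', pow_add _ _ (ite _ _ _), ← sum_mul]
    rw [eq_sub_of_add_eq ih']
    have h0 : v 1 = false → numChanges (insertPeak 0 (fun i => v (i + 1))) (m + 1) =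
        numChanges (fun i => v (i + 1)) m + 1 := by
      intro h1
      rcases m with _ | m
      · simp [numChanges, insertPeak]
      · rw [numChanges_insertPeak_zero, numChanges_succ (fun i => v (i + 1))]
        cases h2 : v 2 <;> simp [h1]
    cases h2 : v 0 <;> cases h1 : v 1 <;> simp [h1, h0] <;> ring

/-- Insert a new maximum into `π` at position `p`. -/
def insertMax {n : ℕ} (p : Fin (n + 1)) (π : Equiv.Perm (Fin n)) : Equiv.Perm (Fin (n + 1)) :=
  ((finSuccEquiv' p).trans (Equiv.optionCongr π)).trans (finSuccEquiv' (Fin.last n)).symm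

lemma insertMax_self {n : ℕ} (p : Fin (n + 1)) (π : Equiv.Perm (Fin n)) :
    insertMax p π p = Fin.last n := by
  simp [insertMax]

lemma insertMax_succAbove {n : ℕ} (p : Fin (n + 1)) (π : Equiv.Perm (Fin n)) (i : Fin n) :
    insertMax p π (p.succAbove i) = (π i).castSucc := by
  simp [insertMax]

lemma insertMax_bijective (n : ℕ) :
    Function.Bijective
      (fun x : Equiv.Perm (Fin n) × Fin (n + 1) => insertMax x.2 x.1) := by
  rw [Fintype.bijective_iff_injective_and_card]
  constructor
  · rintro ⟨π, p⟩ ⟨σ, q⟩ h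
    simp only at h
    have hpq : p = q := by
      apply (insertMax q σ).injective
      rw [insertMax_self, ← h, insertMax_self]
    subst hpq
    have hπσ : π = σ := by
      ext i
      have := congrArg (fun f : Equiv.Perm (Fin (n + 1)) => (f (p.succAbove i)).val) h
      simpa [insertMax_succAbove] using this
    rw [hπσ]
  · simp [Fintype.card_perm, Nat.factorial_succ, mul_comm]

lemma pval_le (n : ℕ) (π : Equiv.Perm (Fin n)) (i : ℕ) : pval n π i ≤ n := by
  unfold pval
  split_ifs <;> omega

lemma pval_insertMax {n : ℕ} (p : Fin (n + 1)) (π : Equiv.Perm (Fin n)) (i : ℕ) :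
    pval (n + 1) (insertMax p π) i =
      if i ≤ p then pval n π i else if i = p + 1 then (n : ℤ) + 1 else pval n π (i - 1) := by
  have hp := p.isLt
  by_cases hi : 1 ≤ i ∧ i ≤ n + 1
  · obtain ⟨j, rfl⟩ : ∃ j, i = j + 1 := ⟨i - 1, by omega⟩
    rcases lt_trichotomy j p.val with hj | hj | hj
    · have h : (⟨j, by omega⟩ : Fin (n + 1)) = p.succAbove ⟨j, by omega⟩ := by
        rw [Fin.succAbove_of_castSucc_lt _ _ (by simpa [Fin.lt_def] using hj)]
        rfl
      rw [if_pos (by omega), pval, pval, dif_pos hi, dif_pos (by omega)]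
      simp only [Nat.add_sub_cancel, h, insertMax_succAbove, Fin.val_castSucc]
    · have h : (⟨j, by omega⟩ : Fin (n + 1)) = p := Fin.ext hj
      rw [if_neg (by omega), if_pos (by omega), pval, dif_pos hi]
      simp only [Nat.add_sub_cancel, h, insertMax_self, Fin.val_last]
    · have h : (⟨j, by omega⟩ : Fin (n + 1)) = p.succAbove ⟨j - 1, by omega⟩ := by
        rw [Fin.succAbove_of_le_castSucc _ _ (by simp [Fin.le_def]; omega)]
        ext
        simp
        omega
      rw [if_neg (by omega), if_neg (by omega), pval, pval, dif_pos hi, dif_pos (by omega)]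
      simp only [Nat.add_sub_cancel, h, insertMax_succAbove, Fin.val_castSucc]
  · unfold pval
    split_ifs <;> first | rfl | omega

/-- The ascent word of `0, π(1), …, π(n)`. -/
def ascentWord (n : ℕ) (π : Equiv.Perm (Fin n)) (i : ℕ) : Bool :=
  decide (pval n π i < pval n π (i + 1))

lemma ascentWord_insertMax {n : ℕ} (p : Fin (n + 1)) (π : Equiv.Perm (Fin n)) :
    ascentWord (n + 1) (insertMax p π) = insertPeak p (ascentWord n π) := by
  funext i
  have h1 := pval_le n π i
  have h2 := pval_le n π (i + 1)
  unfold ascentWord insertPeak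
  rw [pval_insertMax, pval_insertMax]
  rcases lt_trichotomy i p.val with hi | hi | hi
  · simp [hi, hi.le, Nat.succ_le_of_lt hi]
  · subst hi
    simp
    omega
  · obtain ⟨j, rfl⟩ : ∃ j, i = j + 1 := ⟨i - 1, by omega⟩
    have h : ¬ j + 1 ≤ p.val := by omega
    have h' : ¬ j + 1 + 1 ≤ p.val := by omega
    have h3 : ¬ j + 1 < p.val := by omega
    have h4 : j + 1 ≠ p.val := by omega
    by_cases hj : j = p.val
    · simp [hj] at h1 ⊢
      omega
    · simp [h, h', h3, h4, hj]

lemma ascentWord_zero {n : ℕ} (hn : 1 ≤ n) (π : Equiv.Perm (Fin n)) :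
    ascentWord n π 0 = true := by
  simp [ascentWord, pval, hn]

lemma pval_ne_succ {n i : ℕ} (hi : i < n) (π : Equiv.Perm (Fin n)) :
    pval n π i ≠ pval n π (i + 1) := by
  unfold pval
  rw [dif_pos (show 1 ≤ i + 1 ∧ i + 1 ≤ n by omega)]
  split_ifs with h
  · intro heq
    have := π.injective (Fin.ext (by exact_mod_cast add_right_cancel heq))
    simp [Fin.ext_iff] at this
    omega
  · omega

lemma udrun_succ (m : ℕ) (π : Equiv.Perm (Fin (m + 1))) :
    udrun (m + 1) π = numChanges (ascentWord (m + 1) π) m + 1 := by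
  rw [udrun, if_neg (Nat.succ_ne_zero m), add_comm, card_filter, numChanges,
    Nat.add_sub_cancel, ← Finset.Ico_add_one_right_eq_Icc, sum_Ico_eq_sum_range]
  congr 1
  refine sum_congr (by simp) fun i hi => ?_
  rw [mem_range] at hi
  have h1 := pval_ne_succ (show i < m + 1 by omega) π
  have h2 := pval_ne_succ (show i + 1 < m + 1 by omega) π
  rw [add_comm 1 i, Nat.add_sub_cancel]
  simp only [ascentWord, decide_eq_decide]
  split_ifs <;> omega

/-- The differential recurrence of the up-down run polynomials. -/
theorem Tpoly_succ {n : ℕ} (hn : 1 ≤ n) :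
    Tpoly (n + 1) = (C (n : ℝ) * X ^ 2 + X) * Tpoly n +
      X * (1 - X ^ 2) * derivative (Tpoly n) := by
  obtain ⟨m, rfl⟩ : ∃ m, n = m + 1 := ⟨n - 1, by omega⟩
  unfold Tpoly
  rw [← (insertMax_bijective (m + 1)).sum_comp
    (fun π : Equiv.Perm (Fin (m + 1 + 1)) => (X : ℝ[X]) ^ udrun (m + 1 + 1) π),
    Fintype.sum_prod_type, derivative_sum, mul_sum, mul_sum, ← sum_add_distrib]
  refine sum_congr rfl fun π _ => ?_
  simp only [udrun_succ, ascentWord_insertMax, pow_succ _ (numChanges _ _)]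
  rw [← sum_mul, Fin.sum_univ_eq_sum_range
    (fun p => (X : ℝ[X]) ^ numChanges (insertPeak p (ascentWord (m + 1) π)) (m + 1)),
    sum_pow_numChanges_insertPeak, if_pos (ascentWord_zero hn π), ← pow_succ,
    derivative_X_pow]
  simp
  ring

/-- If `R_{n+1}(x) = (nx²+1)·R_n(x) + x(1-x²)·R_n'(x)` with `R_1(x) = 1+x`,
then `x·R_n(x) = (1+x)·T_n(x)` for every `n ≥ 1`, where `T_n` is the up-down
run polynomial. -/
theorem Rpoly_eq_updown_run (R : ℕ → Polynomial ℝ)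
    (hR1 : R 1 = 1 + X)
    (hR : ∀ n : ℕ, 1 ≤ n →
      R (n + 1) = (Polynomial.C (n : ℝ) * X ^ 2 + 1) * R n +
        X * (1 - X ^ 2) * derivative (R n)) :
    ∀ n : ℕ, 1 ≤ n → X * R n = (1 + X) * Tpoly n := by
  intro n hn
  induction n, hn using Nat.le_induction with
  | base =>
    have h : Tpoly 1 = X := by simp [Tpoly, udrun]
    rw [hR1, h, mul_comm]
  | succ n hn ih =>
    have ih' := congrArg derivative ih
    simp only [derivative_mul, derivative_add, derivative_one, derivative_X] at ih'
    rw [hR n hn, Tpoly_succ hn]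
    linear_combination (C (n : ℝ) * X ^ 2 + 1) * ih + X * (1 - X ^ 2) * ih' - (1 - X ^ 2) * ih
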